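/- arXiv:0706.1725 — 2 statements merged into one kernel-verified Lean document; each statement's English description precedes it below -/
import Mathlib

section
/- Fix an integer k ≥ 2, β > 0, and a positive multiple n of k. Let F be the subspace of k×k real matrices all of whose row sums and column sums are 0, let B_∞ be the set of k×k matrices with all entries in [−1/2, 1/2], and let J_k be the k×k matrix with all entries 1/k. For a k×k nonnegative integer matrix L with all row and column sums equal to n/k, let ρ_L = Σ_{i,j} ℓ_ij² and let T(L) = L − (n/k)·J_k + (F ∩ B_∞). Then exp( −βn·( (k²/n²)·ρ_L − 1 ) ) ≤ exp( k⁴β/(4n) ) · ∫_{T(L)} exp( −(k²β/(2n))·‖X‖₂² ) dX, where the integral is with respect to (k−1)²-dimensional Lebesgue measure on the affine subspace L − (n/k)·J_k + F, and ‖X‖₂² = Σ_{i,j} x_ij². -/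
open Finset MeasureTheory

/-- The subspace `F` of `k × k` real matrices — realized as `EuclideanSpace ℝ (Fin k × Fin k)`,
so that the norm is the Frobenius (entrywise) 2-norm — all of whose row sums and column
sums vanish. -/
def zeroSumSubspace (k : ℕ) : Submodule ℝ (EuclideanSpace ℝ (Fin k × Fin k)) where
  carrier := {X | (∀ i, ∑ j, X (i, j) = 0) ∧ (∀ j, ∑ i, X (i, j) = 0)}
  add_mem' := by
    intro a b ha hb
    refine ⟨fun i => ?_, fun j => ?_⟩
    · simp [PiLp.add_apply, Finset.sum_add_distrib, ha.1 i, hb.1 i]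
    · simp [PiLp.add_apply, Finset.sum_add_distrib, ha.2 j, hb.2 j]
  zero_mem' := by
    refine ⟨fun i => ?_, fun j => ?_⟩ <;> simp
  smul_mem' := by
    intro c x hx
    refine ⟨fun i => ?_, fun j => ?_⟩
    · simp [PiLp.smul_apply, smul_eq_mul, ← Finset.mul_sum, hx.1 i]
    · simp [PiLp.smul_apply, smul_eq_mul, ← Finset.mul_sum, hx.2 j]

noncomputable instance (k : ℕ) : MeasurableSpace (zeroSumSubspace k) := borel _

instance (k : ℕ) : BorelSpace (zeroSumSubspace k) := ⟨rfl⟩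

/-- One-dimensional Brunn–Minkowski inequality. -/
theorem volume_add_volume_le_of_add_mem {A B C : Set ℝ} (hA : MeasurableSet A)
    (hB : MeasurableSet B) (hA' : A.Nonempty) (hB' : B.Nonempty)
    (h : ∀ x ∈ A, ∀ y ∈ B, x + y ∈ C) : volume A + volume B ≤ volume C := by
  have key : ∀ K ⊆ A, IsCompact K → K.Nonempty → ∀ L ⊆ B, IsCompact L → L.Nonempty →
      volume K + volume L ≤ volume C := by
    intro K hKA hK hK' L hLB hL hL'
    have hM := hK.sSup_mem hK'
    have hm := hL.sInf_mem hL'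
    set M := sSup K
    set m := sInf L
    have h1 : volume K ≤ volume (C ∩ Set.Iic (M + m)) := by
      rw [← measure_preimage_add_right volume (-m) K]
      refine measure_mono fun x hx => ?_
      have hx' : x - m ∈ K := hx
      have h2 := h _ (hKA hx') _ (hLB hm)
      have h3 := le_csSup hK.bddAbove hx'
      refine ⟨by simpa using h2, ?_⟩
      simp only [Set.mem_Iic]
      linarith
    have h2 : volume L ≤ volume (C \ Set.Iic (M + m)) := by
      rw [← measure_preimage_add_right volume (-M) L]
      have : (fun x => x + -M) ⁻¹' L ⊆ (C \ Set.Iic (M + m)) ∪ {M + m} := by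
        intro x hx
        have hx' : x - M ∈ L := hx
        have h2 := h _ (hKA hM) _ (hLB hx')
        have h3 := csInf_le hL.bddBelow hx'
        have h4 : M + m ≤ x := by linarith
        rcases h4.eq_or_lt with h5 | h5
        · right; simp [h5]
        · left; exact ⟨by simpa using h2, by simpa using h5⟩
      refine (measure_mono this).trans ((measure_union_le _ _).trans ?_)
      simp
    calc volume K + volume L ≤ _ := add_le_add h1 h2
      _ = volume C := measure_inter_add_sdiff _ measurableSet_Iic
  obtain ⟨x₀, hx₀⟩ := hA'
  obtain ⟨y₀, hy₀⟩ := hB'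
  have key' : ∀ K ⊆ A, IsCompact K → ∀ L ⊆ B, IsCompact L →
      volume K + volume L ≤ volume C := by
    intro K hKA hK L hLB hL
    refine le_trans ?_ (key (insert x₀ K) (Set.insert_subset hx₀ hKA) (hK.insert _)
      (Set.insert_nonempty _ _) (insert y₀ L) (Set.insert_subset hy₀ hLB) (hL.insert _)
      (Set.insert_nonempty _ _))
    gcongr <;> exact Set.subset_insert _ _
  by_cases hA0 : volume A = 0
  · rw [hA0, zero_add, hB.measure_eq_iSup_isCompact]
    refine iSup₂_le fun L hLB => iSup_le fun hL => ?_
    simpa using key' ∅ (Set.empty_subset _) isCompact_empty L hLB hL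
  by_cases hB0 : volume B = 0
  · rw [hB0, add_zero, hA.measure_eq_iSup_isCompact]
    refine iSup₂_le fun K hKA => iSup_le fun hK => ?_
    simpa using key' K hKA hK ∅ (Set.empty_subset _) isCompact_empty
  by_contra! hlt
  obtain ⟨r, hr, s, hs, hrs⟩ := ENNReal.exists_lt_add_of_lt_add hlt hA0 hB0
  obtain ⟨K, hKA, hK, hrK⟩ := hA.exists_lt_isCompact hr
  obtain ⟨L, hLB, hL, hsL⟩ := hB.exists_lt_isCompact hs
  exact (hrs.trans_le (add_le_add hrK.le hsL.le)).not_ge (key' K hKA hK L hLB hL)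

/-- The weighted arithmetic–geometric mean inequality in `ENNReal`. -/
theorem ENNReal.rpow_mul_rpow_le_add {a b : ℝ} (ha : 0 < a) (hb : 0 < b) (hab : a + b = 1)
    (x y : ENNReal) :
    x ^ a * y ^ b ≤ ENNReal.ofReal a * x + ENNReal.ofReal b * y := by
  have ha' : ENNReal.ofReal a ≠ 0 := by simpa using ha
  have hb' : ENNReal.ofReal b ≠ 0 := by simpa using hb
  by_cases hx : x = ⊤
  · simp [hx, ENNReal.mul_top ha']
  by_cases hy : y = ⊤
  · simp [hy, ENNReal.mul_top hb']
  lift x to NNReal using hx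
  lift y to NNReal using hy
  lift a to NNReal using ha.le
  lift b to NNReal using hb.le
  rw [← ENNReal.coe_rpow_of_nonneg x (NNReal.coe_nonneg a),
    ← ENNReal.coe_rpow_of_nonneg y (NNReal.coe_nonneg b),
    ENNReal.ofReal_coe_nnreal, ENNReal.ofReal_coe_nnreal]
  exact_mod_cast NNReal.geom_mean_le_arith_mean2_weighted a b x y (by exact_mod_cast hab)

/-- The additive form of the Prékopa–Leindler inequality on the line, for functions with
supremum one. -/
theorem add_lintegral_le_of_rpow_mul_rpow_le {f g h : ℝ → ℝ} (hf : Measurable f)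
    (hg : Measurable g) (hh : Measurable h) (hf0 : ∀ x, 0 ≤ f x) (hg0 : ∀ x, 0 ≤ g x)
    (hh0 : ∀ x, 0 ≤ h x) (hf1 : ∀ x, f x ≤ 1) (hg1 : ∀ x, g x ≤ 1)
    (hf' : ∀ t < 1, ∃ x, t < f x) (hg' : ∀ t < 1, ∃ x, t < g x)
    {a b : ℝ} (ha : 0 < a) (hb : 0 < b) (hab : a + b = 1)
    (H : ∀ x y, f x ^ a * g y ^ b ≤ h (a * x + b * y)) :
    ENNReal.ofReal a * (∫⁻ x, ENNReal.ofReal (f x)) +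
      ENNReal.ofReal b * (∫⁻ x, ENNReal.ofReal (g x))
      ≤ ∫⁻ x, ENNReal.ofReal (h x) := by
  have mf : ∀ f : ℝ → ℝ, Measurable fun t => volume {x | t < f x} := fun f => by
    refine Antitone.measurable fun s t hst => measure_mono fun x hx => ?_
    exact lt_of_le_of_lt hst hx
  rw [lintegral_eq_lintegral_meas_lt _ (.of_forall hf0) hf.aemeasurable,
    lintegral_eq_lintegral_meas_lt _ (.of_forall hg0) hg.aemeasurable,
    lintegral_eq_lintegral_meas_lt _ (.of_forall hh0) hh.aemeasurable,
    ← lintegral_const_mul _ (mf f), ← lintegral_const_mul _ (mf g),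
    ← lintegral_add_left ((mf f).const_mul _)]
  refine setLIntegral_mono (mf h) fun t ht => ?_
  have ht0 : 0 < t := ht
  rcases lt_or_ge t 1 with ht1 | ht1
  · have hs : ∀ (c : ℝ) (hc : 0 < c) (s : Set ℝ),
        ENNReal.ofReal c * volume s = volume ((fun x => c⁻¹ * x) ⁻¹' s) := by
      intro c hc s
      rw [Real.volume_preimage_mul_left (inv_ne_zero hc.ne'), inv_inv, abs_of_pos hc]
    rw [hs a ha, hs b hb]
    obtain ⟨x₀, hx₀⟩ := hf' t ht1
    obtain ⟨y₀, hy₀⟩ := hg' t ht1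
    refine volume_add_volume_le_of_add_mem ?_ ?_ ⟨a * x₀, ?_⟩ ⟨b * y₀, ?_⟩ ?_
    · exact (measurableSet_lt measurable_const hf).preimage (measurable_const_mul _)
    · exact (measurableSet_lt measurable_const hg).preimage (measurable_const_mul _)
    · simpa [ha.ne'] using hx₀
    · simpa [hb.ne'] using hy₀
    · intro x hx y hy
      simp only [Set.mem_preimage, Set.mem_ofPred_eq] at hx hy ⊢
      have := H (a⁻¹ * x) (b⁻¹ * y)
      rw [mul_inv_cancel_left₀ ha.ne', mul_inv_cancel_left₀ hb.ne'] at this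
      refine lt_of_lt_of_le ?_ this
      calc t = t ^ a * t ^ b := by rw [← Real.rpow_add ht0, hab, Real.rpow_one]
        _ < _ := mul_lt_mul'' (Real.rpow_lt_rpow ht0.le hx ha) (Real.rpow_lt_rpow ht0.le hy hb)
          (by positivity) (by positivity)
  · have e1 : {x | t < f x} = ∅ := by
      ext x; simpa using (hf1 x).trans ht1
    have e2 : {x | t < g x} = ∅ := by
      ext x; simpa using (hg1 x).trans ht1
    simp [e1, e2]

theorem lintegral_rpow_mul_le_of_bounded {f g h : ℝ → ENNReal} (hf : Measurable f)
    (hg : Measurable g) (hh : Measurable h) {c : ENNReal} (hc : c ≠ ⊤) (hfc : ∀ x, f x ≤ c)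
    (hgc : ∀ x, g x ≤ c)
    {a b : ℝ} (ha : 0 < a) (hb : 0 < b) (hab : a + b = 1)
    (H : ∀ x y, f x ^ a * g y ^ b ≤ h (a * x + b * y)) :
    (∫⁻ x, f x) ^ a * (∫⁻ x, g x) ^ b ≤ ∫⁻ x, h x := by
  by_cases hA : (⨆ x, f x) = 0
  · have : ∀ x, f x = 0 := by simpa using hA
    simp [this, ha]
  by_cases hB : (⨆ x, g x) = 0
  · have : ∀ x, g x = 0 := by simpa using hB
    simp [this, hb]
  have hA' : (⨆ x, f x) ≠ ⊤ := ((iSup_le hfc).trans_lt hc.lt_top).ne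
  have hB' : (⨆ x, g x) ≠ ⊤ := ((iSup_le hgc).trans_lt hc.lt_top).ne
  have hfA : ∀ x, f x ≤ ⨆ x, f x := le_iSup f
  have hgB : ∀ x, g x ≤ ⨆ x, g x := le_iSup g
  have lf : ∀ t : ENNReal, t < ⨆ x, f x → ∃ x, t < f x := fun t => lt_iSup_iff.1
  have lg : ∀ t : ENNReal, t < ⨆ x, g x → ∃ x, t < g x := fun t => lt_iSup_iff.1
  generalize (⨆ x, f x) = A at *
  generalize (⨆ x, g x) = B at *
  set D := A ^ a * B ^ b with hD
  have hD0 : D ≠ 0 := mul_ne_zero (by simp [hA, hA']) (by simp [hB, hB'])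
  have hDt : D ≠ ⊤ := ENNReal.mul_ne_top (by simp [hA, hA'])
    (by simp [hB, hB'])
  have f1 : ∀ x, f x / A ≤ 1 := fun x => ENNReal.div_le_of_le_mul (by simpa using hfA x)
  have g1 : ∀ x, g x / B ≤ 1 := fun x => ENNReal.div_le_of_le_mul (by simpa using hgB x)
  have tt : ∀ x : ENNReal, x ≤ 1 → x ≠ ⊤ := fun x hx => (hx.trans_lt ENNReal.one_lt_top).ne
  have lev : ∀ (A : ENNReal) (f : ℝ → ENNReal), A ≠ 0 → A ≠ ⊤ → (∀ x, f x / A ≤ 1) →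
      (∀ t < A, ∃ x, t < f x) → ∀ t < (1 : ℝ), ∃ x, t < (f x / A).toReal := by
    intro A f h0 ht f1 lf t ht1
    obtain ⟨x, hx⟩ := lf (ENNReal.ofReal t * A) (by
      conv_rhs => rw [← one_mul A]
      exact ENNReal.mul_lt_mul_left h0 ht (by simpa using ht1))
    refine ⟨x, ?_⟩
    have : ENNReal.ofReal t < f x / A := by
      rwa [ENNReal.lt_div_iff_mul_lt (.inl h0) (.inl ht)]
    have h2 := ENNReal.toReal_strict_mono (tt _ (f1 x)) this
    rw [ENNReal.toReal_ofReal'] at h2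
    exact (le_max_left _ _).trans_lt h2
  have key := add_lintegral_le_of_rpow_mul_rpow_le (f := fun x => (f x / A).toReal)
    (g := fun x => (g x / B).toReal) (h := fun x => (min (h x / D) 1).toReal)
    (by fun_prop) (by fun_prop) (by fun_prop) (fun _ => ENNReal.toReal_nonneg)
    (fun _ => ENNReal.toReal_nonneg) (fun _ => ENNReal.toReal_nonneg)
    (fun x => ENNReal.toReal_le_of_le_ofReal zero_le_one (by simpa using f1 x))
    (fun x => ENNReal.toReal_le_of_le_ofReal zero_le_one (by simpa using g1 x))
    (lev A f hA hA' f1 lf) (lev B g hB hB' g1 lg) ha hb hab (by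
      intro x y
      rw [ENNReal.toReal_rpow, ENNReal.toReal_rpow, ← ENNReal.toReal_mul]
      refine ENNReal.toReal_mono (by simp) (le_min ?_ ?_)
      · rw [ENNReal.div_rpow_of_nonneg _ _ ha.le, ENNReal.div_rpow_of_nonneg _ _ hb.le,
          ENNReal.le_div_iff_mul_le (.inl hD0) (.inl hDt)]
        refine le_trans (le_of_eq ?_) (H x y)
        rw [hD, mul_mul_mul_comm,
          ENNReal.div_mul_cancel (by simp [hA, hA']) (by simp [hA, hA']),
          ENNReal.div_mul_cancel (by simp [hB, hB']) (by simp [hB, hB'])]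
      · exact mul_le_one' (ENNReal.rpow_le_one (f1 x) ha.le) (ENNReal.rpow_le_one (g1 y) hb.le))
  simp only [ENNReal.ofReal_toReal (tt _ (f1 _)), ENNReal.ofReal_toReal (tt _ (g1 _)),
    ENNReal.ofReal_toReal (tt _ (min_le_right _ _))] at key
  have key2 := (ENNReal.rpow_mul_rpow_le_add ha hb hab _ _).trans
    (key.trans (lintegral_mono fun x => min_le_left _ _))
  simp only [div_eq_mul_inv] at key2
  rw [lintegral_mul_const _ hf, lintegral_mul_const _ hg, lintegral_mul_const _ hh,
    ← div_eq_mul_inv, ← div_eq_mul_inv, ← div_eq_mul_inv,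
    ENNReal.le_div_iff_mul_le (.inl hD0) (.inl hDt),
    ENNReal.div_rpow_of_nonneg _ _ ha.le, ENNReal.div_rpow_of_nonneg _ _ hb.le,
    hD, mul_mul_mul_comm, ENNReal.div_mul_cancel (by simp [hA, hA']) (by simp [hA, hA']),
    ENNReal.div_mul_cancel (by simp [hB, hB']) (by simp [hB, hB'])] at key2
  exact key2

/-- The Prékopa–Leindler inequality on the line. -/
theorem prekopaLeindler_real {f g h : ℝ → ENNReal} (hf : Measurable f)
    (hg : Measurable g) (hh : Measurable h)
    {a b : ℝ} (ha : 0 < a) (hb : 0 < b) (hab : a + b = 1)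
    (H : ∀ x y, f x ^ a * g y ^ b ≤ h (a * x + b * y)) :
    (∫⁻ x, f x) ^ a * (∫⁻ x, g x) ^ b ≤ ∫⁻ x, h x := by
  by_cases hf0 : ∫⁻ x, f x = 0
  · simp [hf0, ha]
  by_cases hg0 : ∫⁻ x, g x = 0
  · simp [hg0, hb]
  have lim : ∀ f : ℝ → ENNReal, Measurable f → Filter.Tendsto
      (fun n : ℕ => ∫⁻ x, min (f x) n) Filter.atTop (nhds (∫⁻ x, f x)) := by
    intro f hf
    refine lintegral_tendsto_of_tendsto_of_monotone (fun n => by fun_prop)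
      (.of_forall fun x m n hmn => by dsimp only; gcongr) (.of_forall fun x => ?_)
    have := (tendsto_const_nhds (x := f x)).min ENNReal.tendsto_nat_nhds_top
    simpa using this
  have lim2 := ENNReal.Tendsto.mul ((lim f hf).ennrpow_const a) (by simp [hf0, ha.le])
    ((lim g hg).ennrpow_const b) (by simp [hg0, hb.le])
  refine le_of_tendsto' lim2 fun n => ?_
  refine lintegral_rpow_mul_le_of_bounded (by fun_prop) (by fun_prop) hh
    (ENNReal.natCast_ne_top n) (fun x => min_le_right _ _) (fun x => min_le_right _ _)
    ha hb hab fun x y => (le_trans ?_ (H x y))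
  gcongr <;> exact min_le_left _ _

theorem lintegral_fin_succ_eq {n : ℕ} {f : (Fin (n + 1) → ℝ) → ENNReal} (hf : Measurable f) :
    ∫⁻ x, f x = ∫⁻ t : ℝ, ∫⁻ y : Fin n → ℝ, f (Fin.cons t y) := by
  have mp := (volume_preserving_piFinSuccAbove (fun _ : Fin (n + 1) => ℝ) 0).symm
  rw [← mp.lintegral_comp hf, Measure.volume_eq_prod, lintegral_prod _ (by fun_prop)]
  simp [MeasurableEquiv.piFinSuccAbove, Fin.insertNthEquiv]

/-- The Prékopa–Leindler inequality. -/
theorem prekopaLeindler {n : ℕ} {f g h : (Fin n → ℝ) → ENNReal} (hf : Measurable f)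
    (hg : Measurable g) (hh : Measurable h)
    {a b : ℝ} (ha : 0 < a) (hb : 0 < b) (hab : a + b = 1)
    (H : ∀ x y, f x ^ a * g y ^ b ≤ h (a • x + b • y)) :
    (∫⁻ x, f x) ^ a * (∫⁻ x, g x) ^ b ≤ ∫⁻ x, h x := by
  induction n with
  | zero =>
    have e : ∀ f : (Fin 0 → ℝ) → ENNReal, ∫⁻ x, f x = f 0 := fun f => by
      rw [lintegral_unique, volume_pi, Measure.pi_of_empty, measure_univ, mul_one,
        Subsingleton.elim (0 : Fin 0 → ℝ)]
    rw [e, e, e]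
    simpa using H 0 0
  | succ n ih =>
    have mc : Measurable fun p : ℝ × (Fin n → ℝ) => (Fin.cons p.1 p.2 : Fin (n + 1) → ℝ) := by
      refine measurable_pi_lambda _ fun i => ?_
      refine Fin.cases ?_ (fun j => ?_) i
      · simpa using measurable_fst
      · simpa using (by fun_prop : Measurable fun p : ℝ × (Fin n → ℝ) => p.2 j)
    have mi : ∀ f : (Fin (n + 1) → ℝ) → ENNReal, Measurable f →
        Measurable fun t : ℝ => ∫⁻ y : Fin n → ℝ, f (Fin.cons t y) := fun f hf =>
      (hf.comp mc).lintegral_prod_right'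
    have ms : ∀ (f : (Fin (n + 1) → ℝ) → ENNReal) (t : ℝ), Measurable f →
        Measurable fun y : Fin n → ℝ => f (Fin.cons t y) := fun f t hf =>
      (hf.comp mc).comp measurable_prodMk_left
    rw [lintegral_fin_succ_eq hf, lintegral_fin_succ_eq hg, lintegral_fin_succ_eq hh]
    refine prekopaLeindler_real (mi f hf) (mi g hg) (mi h hh) ha hb hab fun s t => ?_
    refine ih (ms f s hf) (ms g t hg) (ms h _ hh) fun x y => ?_
    refine (H _ _).trans_eq (congrArg h ?_)
    ext i
    refine Fin.cases ?_ (fun j => ?_) i <;> simp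

/-- Log-concavity of an extended nonnegative function. -/
def IsLogConcave {E : Type*} [Add E] [SMul ℝ E] (f : E → ENNReal) : Prop :=
  ∀ x y : E, ∀ a b : ℝ, 0 < a → 0 < b → a + b = 1 → f x ^ a * f y ^ b ≤ f (a • x + b • y)

/-- Among probability densities bounded by one, the uniform density on the centred unit interval
maximises the integral of a function that is nonincreasing in `|t|`. -/
theorem lintegral_mul_le_lintegral_indicator {φ w : ℝ → ENNReal} (hφ : Measurable φ)
    (hw : Measurable w) (hanti : ∀ s t : ℝ, |s| ≤ |t| → φ t ≤ φ s) (hw1 : ∀ t, w t ≤ 1)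
    (hwi : ∫⁻ t, w t = 1) :
    ∫⁻ t, φ t * w t ≤ ∫⁻ t in Set.Icc (-(1 / 2) : ℝ) (1 / 2), φ t := by
  set I : Set ℝ := Set.Icc (-(1 / 2) : ℝ) (1 / 2) with hI
  have mI : MeasurableSet I := measurableSet_Icc
  have mem : ∀ t, t ∈ I ↔ |t| ≤ |(1 / 2 : ℝ)| := fun t => by
    rw [abs_of_pos (by norm_num : (0 : ℝ) < 1 / 2), abs_le, hI, Set.mem_Icc]
  have hc : ∫⁻ t in Iᶜ, w t = ∫⁻ t in I, (1 - w t) := by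
    have h1 : (∫⁻ t in I, w t) + ∫⁻ t in Iᶜ, w t = 1 := by
      rw [lintegral_add_compl _ mI, hwi]
    have h2 : (∫⁻ t in I, w t) + ∫⁻ t in I, (1 - w t) = 1 := by
      rw [← lintegral_add_left hw]
      simp only [add_tsub_cancel_of_le (hw1 _)]
      simp [hI]
      norm_num
    have h3 : ∫⁻ t in I, w t ≠ ⊤ :=
      ((setLIntegral_le_lintegral I w).trans_lt (by simp [hwi])).ne
    exact (ENNReal.add_right_inj h3).1 (h1.trans h2.symm)
  calc ∫⁻ t, φ t * w t = (∫⁻ t in I, φ t * w t) + ∫⁻ t in Iᶜ, φ t * w t :=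
        (lintegral_add_compl _ mI).symm
    _ ≤ (∫⁻ t in I, φ t * w t) + ∫⁻ t in Iᶜ, φ (1 / 2) * w t := by
        refine add_le_add le_rfl ?_
        refine setLIntegral_mono (by fun_prop) fun t ht => ?_
        gcongr
        refine hanti _ _ (le_of_not_ge fun h => ht ((mem t).2 h))
    _ = (∫⁻ t in I, φ t * w t) + ∫⁻ t in I, φ (1 / 2) * (1 - w t) := by
        rw [lintegral_const_mul _ hw, lintegral_const_mul _ (by fun_prop), hc]
    _ ≤ (∫⁻ t in I, φ t * w t) + ∫⁻ t in I, φ t * (1 - w t) := by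
        refine add_le_add le_rfl ?_
        refine setLIntegral_mono (by fun_prop) fun t ht => ?_
        gcongr
        exact hanti _ _ ((mem t).1 ht)
    _ = ∫⁻ t in I, φ t := by
        rw [← lintegral_add_left (by fun_prop)]
        simp only [← mul_add, add_tsub_cancel_of_le (hw1 _), mul_one]

theorem LinearMap.exists_equiv_real_prod_fst {E : Type*} [AddCommGroup E] [Module ℝ E]
    [FiniteDimensional ℝ E] (l : E →ₗ[ℝ] ℝ) (hl : l ≠ 0) :
    ∃ (n : ℕ) (e : (ℝ × (Fin n → ℝ)) ≃ₗ[ℝ] E), ∀ p, l (e p) = p.1 := by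
  obtain ⟨v, hv⟩ := LinearMap.surjective hl 1
  let i : (Fin (Module.finrank ℝ (LinearMap.ker l)) → ℝ) ≃ₗ[ℝ] LinearMap.ker l :=
    LinearEquiv.ofFinrankEq _ _ (by simp)
  let T : (ℝ × (Fin (Module.finrank ℝ (LinearMap.ker l)) → ℝ)) →ₗ[ℝ] E :=
    (LinearMap.toSpanSingleton ℝ E v).coprod ((LinearMap.ker l).subtype ∘ₗ i.toLinearMap)
  have hT : ∀ p, T p = p.1 • v + i p.2 := fun p => by simp [T]
  have hlT : ∀ p, l (T p) = p.1 := fun p => by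
    rw [hT, map_add, map_smul, hv, LinearMap.mem_ker.1 (i p.2).2]; simp
  refine ⟨_, LinearEquiv.ofBijective T ⟨?_, fun x => ?_⟩, hlT⟩
  · refine (injective_iff_map_eq_zero T).2 fun p hp => ?_
    have h1 : p.1 = 0 := by rw [← hlT, hp, map_zero]
    have h2 : p.2 = 0 := by simpa [hT, h1] using hp
    exact Prod.ext h1 h2
  · refine ⟨(l x, i.symm ⟨x - l x • v, by simp [hv]⟩), by simp [hT]⟩

/-- Replacing, in one direction, a density bounded by one by the uniform density on the centred
unit interval increases the integral against an even log-concave function. -/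
theorem IsLogConcave.lintegral_mul_comp_le {E : Type*} [NormedAddCommGroup E] [NormedSpace ℝ E]
    [FiniteDimensional ℝ E] [MeasurableSpace E] [BorelSpace E] (μ : Measure E)
    [μ.IsAddHaarMeasure] {f : E → ENNReal} (hf : Measurable f) (hlc : IsLogConcave f)
    (heven : ∀ x, f (-x) = f x) {w : ℝ → ENNReal} (hw : Measurable w) (hw1 : ∀ t, w t ≤ 1)
    (hwi : ∫⁻ t, w t = 1) (l : E →ₗ[ℝ] ℝ) :
    ∫⁻ x, f x * w (l x) ∂μ ≤
      ∫⁻ x, f x * (Set.Icc (-(1 / 2) : ℝ) (1 / 2)).indicator 1 (l x) ∂μ := by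
  by_cases hl : l = 0
  · refine lintegral_mono fun x => ?_
    dsimp only
    gcongr
    simpa [hl] using hw1 0
  obtain ⟨n, e, he⟩ := l.exists_equiv_real_prod_fst hl
  let e' := e.toContinuousLinearEquiv
  have : (volume : Measure (ℝ × (Fin n → ℝ))).IsAddHaarMeasure := by
    rw [Measure.volume_eq_prod]; infer_instance
  have := e'.isAddHaarMeasure_map (volume : Measure (ℝ × (Fin n → ℝ)))
  have hμ : μ = μ.addHaarScalarFactor ((volume : Measure (ℝ × (Fin n → ℝ))).map e') •
      (volume : Measure (ℝ × (Fin n → ℝ))).map e' :=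
    Measure.isAddLeftInvariant_eq_smul _ _
  rw [hμ, lintegral_smul_measure, lintegral_smul_measure]
  gcongr _ • ?_
  have ml : Measurable l := l.continuous_of_finiteDimensional.measurable
  have me : Measurable e' := e'.continuous.measurable
  have mu : Measurable ((Set.Icc (-(1 / 2) : ℝ) (1 / 2)).indicator (1 : ℝ → ENNReal)) :=
    measurable_one.indicator measurableSet_Icc
  rw [lintegral_map (by fun_prop) me, lintegral_map (by fun_prop) me,
    Measure.volume_eq_prod, lintegral_prod _ (by fun_prop), lintegral_prod _ (by fun_prop)]
  have he' : ∀ p, l (e' p) = p.1 := he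
  have mfe : Measurable fun p => f (e' p) := hf.comp me
  simp only [he']
  have ms : ∀ t : ℝ, Measurable fun y => f (e' (t, y)) := fun t =>
    mfe.comp measurable_prodMk_left
  simp only [lintegral_mul_const _ (ms _)]
  have hφ : Measurable fun t : ℝ => ∫⁻ y : Fin n → ℝ, f (e' (t, y)) :=
    mfe.lintegral_prod_right'
  have hφe : ∀ t : ℝ, ∫⁻ y : Fin n → ℝ, f (e' (-t, y)) = ∫⁻ y : Fin n → ℝ, f (e' (t, y)) := by
    intro t
    rw [← lintegral_neg_eq_self]
    refine lintegral_congr fun y => ?_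
    rw [← heven, ← map_neg]
    simp
  refine (lintegral_mul_le_lintegral_indicator hφ hw ?_ hw1 hwi).trans_eq ?_
  · intro s t hst
    rcases hst.lt_or_eq with hst | hst
    · have ht : 0 < |t| := (abs_nonneg s).trans_lt hst
      have ht' : t ≠ 0 := abs_pos.1 ht
      have hq : |s / t| < 1 := by rwa [abs_div, div_lt_one ht]
      obtain ⟨hq1, hq2⟩ := abs_lt.1 hq
      have ha : 0 < (1 + s / t) / 2 := by linarith
      have hb : 0 < (1 - s / t) / 2 := by linarith
      have hab : (1 + s / t) / 2 + (1 - s / t) / 2 = 1 := by ring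
      have key := prekopaLeindler (ms t) (ms (-t)) (ms s) ha hb hab fun x y => by
        refine (hlc _ _ _ _ ha hb hab).trans_eq ?_
        rw [← map_smul, ← map_smul, ← map_add]
        congr 2
        refine Prod.ext ?_ rfl
        simp only [Prod.fst_add, Prod.smul_fst, smul_eq_mul]
        field_simp
        ring
      rwa [hφe, ← ENNReal.rpow_add_of_nonneg _ _ ha.le hb.le, hab, ENNReal.rpow_one] at key
    · rcases abs_eq_abs.1 hst with rfl | rfl
      · exact le_rfl
      · exact (hφe t).ge
  · rw [← lintegral_indicator measurableSet_Icc]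
    refine lintegral_congr fun t => ?_
    by_cases ht : t ∈ Set.Icc (-(1 / 2) : ℝ) (1 / 2)
    · rw [Set.indicator_of_mem ht, Set.indicator_of_mem ht]; simp
    · rw [Set.indicator_of_notMem ht, Set.indicator_of_notMem ht]; simp

theorem IsLogConcave.comp_linearMap {E F : Type*} [AddCommGroup E] [Module ℝ E] [AddCommGroup F]
    [Module ℝ F] {f : F → ENNReal} (hf : IsLogConcave f) (l : E →ₗ[ℝ] F) :
    IsLogConcave fun x => f (l x) := fun x y a b ha hb hab => by
  simpa using hf (l x) (l y) a b ha hb hab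

theorem IsLogConcave.prod {E ι : Type*} [Add E] [SMul ℝ E] (s : Finset ι)
    {f : ι → E → ENNReal} (hf : ∀ i ∈ s, IsLogConcave (f i)) :
    IsLogConcave fun x => ∏ i ∈ s, f i x := fun x y a b ha hb hab => by
  dsimp only
  rw [← ENNReal.prod_rpow_of_nonneg ha.le, ← ENNReal.prod_rpow_of_nonneg hb.le,
    ← Finset.prod_mul_distrib]
  exact Finset.prod_le_prod' fun i hi => hf i hi x y a b ha hb hab

theorem isLogConcave_indicator {E : Type*} [AddCommGroup E] [Module ℝ E] {s : Set E}
    (hs : Convex ℝ s) : IsLogConcave (s.indicator (1 : E → ENNReal)) := by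
  intro x y a b ha hb hab
  by_cases hx : x ∈ s
  · by_cases hy : y ∈ s
    · simp [hx, hy, hs hx hy ha.le hb.le hab]
    · simp [hy, hb]
  · simp [hx, ha]

theorem isLogConcave_gaussian {c : ℝ} (hc : 0 ≤ c) :
    IsLogConcave fun t : ℝ => ENNReal.ofReal (Real.exp (-c * t ^ 2)) := by
  intro x y a b ha hb hab
  dsimp only
  rw [ENNReal.ofReal_rpow_of_pos (Real.exp_pos _), ENNReal.ofReal_rpow_of_pos (Real.exp_pos _),
    ← ENNReal.ofReal_mul (by positivity), ← Real.exp_mul, ← Real.exp_mul, ← Real.exp_add]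
  refine ENNReal.ofReal_le_ofReal (Real.exp_le_exp.2 ?_)
  obtain rfl : b = 1 - a := by linarith
  simp only [smul_eq_mul]
  nlinarith [mul_nonneg hc (mul_nonneg (mul_nonneg ha.le hb.le) (sq_nonneg (x - y)))]

/-- Vaaler's theorem: a central section of the unit cube has volume at least one. -/
theorem one_le_volume_abs_le_half {E ι : Type*} [NormedAddCommGroup E] [InnerProductSpace ℝ E]
    [FiniteDimensional ℝ E] [MeasurableSpace E] [BorelSpace E] [Fintype ι]
    (l : ι → E →ₗ[ℝ] ℝ) (hl : ∀ x, ∑ i, l i x ^ 2 = ‖x‖ ^ 2) :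
    1 ≤ volume {x : E | ∀ i, |l i x| ≤ 1 / 2} := by
  classical
  set w : ℝ → ENNReal := fun t => ENNReal.ofReal (Real.exp (-Real.pi * t ^ 2)) with hw
  set u : ℝ → ENNReal := (Set.Icc (-(1 / 2) : ℝ) (1 / 2)).indicator 1 with hu
  have mw : Measurable w := by fun_prop
  have mu : Measurable u := measurable_one.indicator measurableSet_Icc
  have w1 : ∀ t, w t ≤ 1 := fun t => by
    simp only [hw, ENNReal.ofReal_le_one, Real.exp_le_one_iff]
    nlinarith [Real.pi_pos, sq_nonneg t]
  have wi : ∫⁻ t, w t = 1 := by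
    rw [← ofReal_integral_eq_lintegral_ofReal (integrable_exp_neg_mul_sq Real.pi_pos)
      (.of_forall fun t => (Real.exp_pos _).le), integral_gaussian, div_self Real.pi_ne_zero]
    simp
  have ml : ∀ i, Measurable (l i) := fun i => (l i).continuous_of_finiteDimensional.measurable
  let v : Finset ι → ι → ℝ → ENNReal := fun S i => if i ∈ S then u else w
  have mv : ∀ S i, Measurable (v S i) := fun S i => by
    simp only [v]; split_ifs <;> assumption
  have lv : ∀ S i, IsLogConcave (v S i) := fun S i => by
    simp only [v]; split_ifs
    · exact isLogConcave_indicator (convex_Icc _ _)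
    · exact isLogConcave_gaussian Real.pi_pos.le
  have ev : ∀ S i t, v S i (-t) = v S i t := fun S i t => by
    simp only [v]; split_ifs
    · have : -t ∈ Set.Icc (-(1 / 2) : ℝ) (1 / 2) ↔ t ∈ Set.Icc (-(1 / 2) : ℝ) (1 / 2) := by
        rw [Set.mem_Icc, Set.mem_Icc, ← abs_le, ← abs_le, abs_neg]
      simp only [hu, Set.indicator_apply, this, Pi.one_apply]
    · simp [hw]
  have key : ∀ S : Finset ι, 1 ≤ ∫⁻ x, ∏ i, v S i (l i x) := by
    intro S
    induction S using Finset.induction_on with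
    | empty =>
      have h1 : ∀ x, ∏ i, v ∅ i (l i x) = ENNReal.ofReal (Real.exp (-Real.pi * ‖x‖ ^ 2)) := by
        intro x
        simp only [v, Finset.notMem_empty, if_false, hw]
        rw [← ENNReal.ofReal_prod_of_nonneg fun _ _ => (Real.exp_pos _).le, ← Real.exp_sum,
          ← Finset.mul_sum, hl]
      simp only [h1]
      have h2 := GaussianFourier.integral_rexp_neg_mul_sq_norm (V := E) Real.pi_pos
      rw [div_self Real.pi_ne_zero, Real.one_rpow] at h2
      rw [← ofReal_integral_eq_lintegral_ofReal
        (Integrable.of_integral_ne_zero (by rw [h2]; exact one_ne_zero))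
        (.of_forall fun t => (Real.exp_pos _).le), h2]
      simp
    | insert j S hj ih =>
      have split : ∀ T x, ∏ i, v T i (l i x) =
          (∏ i ∈ univ.erase j, v T i (l i x)) * v T j (l j x) := fun T x =>
        (Finset.prod_erase_mul _ _ (Finset.mem_univ j)).symm
      have hS : v S j = w := by simp [v, hj]
      have hT : v (insert j S) j = u := by simp [v]
      have hST : ∀ x, ∏ i ∈ univ.erase j, v (insert j S) i (l i x) =
          ∏ i ∈ univ.erase j, v S i (l i x) := fun x =>
        Finset.prod_congr rfl fun i hi => by simp [v, Finset.ne_of_mem_erase hi]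
      refine ih.trans ?_
      simp only [split, hS, hT, hST]
      refine IsLogConcave.lintegral_mul_comp_le volume
        (Finset.measurable_prod _ fun i _ => (mv S i).comp (ml i))
        (IsLogConcave.prod _ fun i _ => (lv S i).comp_linearMap (l i)) (fun x => ?_) mw w1 wi (l j)
      exact Finset.prod_congr rfl fun i _ => by
        rw [Function.comp_apply, Function.comp_apply, map_neg, ev]
  have hset : ∀ x, ∏ i, v univ i (l i x) =
      {x : E | ∀ i, |l i x| ≤ 1 / 2}.indicator 1 x := by
    intro x
    have h1 : ∀ i, v univ i (l i x) = if |l i x| ≤ 1 / 2 then 1 else 0 := fun i => by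
      simp only [v, Finset.mem_univ, if_true, hu, Set.indicator_apply, Set.mem_Icc, ← abs_le,
        Pi.one_apply]
    simp only [h1, Finset.prod_ite_zero, Set.indicator_apply]
    simp
  have ms : MeasurableSet {x : E | ∀ i, |l i x| ≤ 1 / 2} := by
    rw [Set.ofPred_forall]
    exact MeasurableSet.iInter fun i =>
      measurableSet_le ((ml i).abs) measurable_const
  have h := key univ
  simp only [hset] at h
  rwa [lintegral_indicator_one ms] at h

theorem isCompact_zeroSumSubspace_abs_le (k : ℕ) (r : ℝ) :
    IsCompact {Y : zeroSumSubspace k |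
      ∀ p : Fin k × Fin k, |((Y : EuclideanSpace ℝ (Fin k × Fin k)) p)| ≤ r} := by
  refine Metric.isCompact_of_isClosed_isBounded ?_ ?_
  · rw [Set.ofPred_forall]
    exact isClosed_iInter fun p => isClosed_le (by fun_prop) continuous_const
  · refine isBounded_iff_forall_norm_le.2 ⟨√(∑ _p : Fin k × Fin k, r ^ 2), fun Y hY => ?_⟩
    rw [Submodule.coe_norm, EuclideanSpace.norm_eq]
    refine Real.sqrt_le_sqrt (Finset.sum_le_sum fun p _ => ?_)
    exact pow_le_pow_left₀ (norm_nonneg _) (hY p) 2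

theorem one_le_volume_zeroSumSubspace (k : ℕ) :
    1 ≤ volume {Y : zeroSumSubspace k |
      ∀ p : Fin k × Fin k, |((Y : EuclideanSpace ℝ (Fin k × Fin k)) p)| ≤ 1 / 2} :=
  one_le_volume_abs_le_half
    (fun p => (EuclideanSpace.proj p : EuclideanSpace ℝ (Fin k × Fin k) →L[ℝ] ℝ).toLinearMap ∘ₗ
      (zeroSumSubspace k).subtype) fun Y => by
    simp [Submodule.coe_norm, EuclideanSpace.norm_sq_eq]

/-- The Gaussian-integral lower bound over the tile `T(L) = L - (n/k) J_k + (F ∩ B_∞)`: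
`exp(-βn((k²/n²)ρ_L - 1)) ≤ exp(k⁴β/(4n)) ∫_{T(L)} exp(-(k²β/(2n))‖X‖₂²) dX`, where the
integral over `T(L)` (with respect to `(k-1)²`-dimensional Lebesgue measure on the affine
subspace `L - (n/k)J_k + F`) is parametrized by `Y ∈ F ∩ B_∞`, `X = L - (n/k)J_k + Y`. -/
theorem tile_integral_bound (k n : ℕ) (hk : 2 ≤ k) (hn : 0 < n) (hdvd : k ∣ n)
    (β : ℝ) (hβ : 0 < β)
    (L : Matrix (Fin k) (Fin k) ℕ)
    (hrow : ∀ i, ∑ j, L i j = n / k) (hcol : ∀ j, ∑ i, L i j = n / k) :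
    Real.exp (-(β * n) * ((k : ℝ) ^ 2 / (n : ℝ) ^ 2 * (∑ i, ∑ j, (L i j : ℝ) ^ 2) - 1)) ≤
      Real.exp ((k : ℝ) ^ 4 * β / (4 * n)) *
        ∫ Y in {Y : zeroSumSubspace k |
            ∀ p : Fin k × Fin k, |((Y : EuclideanSpace ℝ (Fin k × Fin k)) p)| ≤ 1 / 2},
          Real.exp (-((k : ℝ) ^ 2 * β / (2 * n)) *
            ∑ p : Fin k × Fin k,
              ((L p.1 p.2 : ℝ) - (n : ℝ) / (k : ℝ) ^ 2 +
                (Y : EuclideanSpace ℝ (Fin k × Fin k)) p) ^ 2) := by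
  set c : ℝ := (k : ℝ) ^ 2 * β / (2 * n) with hc
  set S := {Y : zeroSumSubspace k |
    ∀ p : Fin k × Fin k, |((Y : EuclideanSpace ℝ (Fin k × Fin k)) p)| ≤ 1 / 2} with hS
  have hk0 : (k : ℝ) ≠ 0 := by positivity
  have hn0 : (n : ℝ) ≠ 0 := by positivity
  have hc0 : 0 < c := by positivity
  have hSc : IsCompact S := isCompact_zeroSumSubspace_abs_le k _
  set A : Fin k × Fin k → ℝ := fun p => (L p.1 p.2 : ℝ) - (n : ℝ) / (k : ℝ) ^ 2 with hA
  have hrow' : ∀ i, ∑ j, (L i j : ℝ) = n / k := fun i => by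
    rw [← Nat.cast_div hdvd hk0, ← hrow i, Nat.cast_sum]
  have hAsq : ∑ p, A p ^ 2 = (∑ i, ∑ j, (L i j : ℝ) ^ 2) - (n : ℝ) ^ 2 / (k : ℝ) ^ 2 := by
    have h1 : ∀ i, ∑ j, A (i, j) ^ 2 = (∑ j, (L i j : ℝ) ^ 2) - (n : ℝ) ^ 2 / (k : ℝ) ^ 3 := by
      intro i
      have h2 : ∀ j, A (i, j) ^ 2 = (L i j : ℝ) ^ 2 - 2 * (n / (k : ℝ) ^ 2) * L i j +
          (n / (k : ℝ) ^ 2) ^ 2 := fun j => by simp only [hA]; ring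
      simp only [h2, Finset.sum_add_distrib, Finset.sum_sub_distrib, ← Finset.mul_sum, hrow',
        Finset.sum_const, Finset.card_univ, Fintype.card_fin, nsmul_eq_mul]
      field_simp
      ring
    rw [Fintype.sum_prod_type]
    simp only [h1, Finset.sum_sub_distrib, Finset.sum_const, Finset.card_univ, Fintype.card_fin,
      nsmul_eq_mul]
    field_simp
  have hlhs : -(β * n) * ((k : ℝ) ^ 2 / (n : ℝ) ^ 2 * (∑ i, ∑ j, (L i j : ℝ) ^ 2) - 1) =
      -c * (2 * ∑ p, A p ^ 2) := by
    rw [hAsq, hc]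
    field_simp
  have hbound : ∀ Y ∈ S, Real.exp (-c * (2 * ∑ p, A p ^ 2 + (k : ℝ) ^ 2 / 2)) ≤
      Real.exp (-c * ∑ p : Fin k × Fin k,
        (A p + (Y : EuclideanSpace ℝ (Fin k × Fin k)) p) ^ 2) := by
    intro Y hY
    refine Real.exp_le_exp.2 (mul_le_mul_of_nonpos_left ?_ (by linarith))
    calc ∑ p, (A p + (Y : EuclideanSpace ℝ (Fin k × Fin k)) p) ^ 2
        ≤ ∑ p : Fin k × Fin k, (2 * A p ^ 2 + 1 / 2) := by
          refine Finset.sum_le_sum fun p _ => ?_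
          have h1 := abs_le.1 (hY p)
          nlinarith [sq_nonneg (A p - (Y : EuclideanSpace ℝ (Fin k × Fin k)) p)]
      _ = 2 * ∑ p, A p ^ 2 + (k : ℝ) ^ 2 / 2 := by
          rw [Finset.sum_add_distrib, ← Finset.mul_sum]
          simp
          ring
  have hvol : 1 ≤ volume.real S :=
    (ENNReal.toReal_mono hSc.measure_lt_top.ne (one_le_volume_zeroSumSubspace k)).trans'
      (by simp)
  have hint : Real.exp (-c * (2 * ∑ p, A p ^ 2 + (k : ℝ) ^ 2 / 2)) ≤
      ∫ Y in S, Real.exp (-c * ∑ p : Fin k × Fin k,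
        (A p + (Y : EuclideanSpace ℝ (Fin k × Fin k)) p) ^ 2) := by
    calc _ ≤ Real.exp (-c * (2 * ∑ p, A p ^ 2 + (k : ℝ) ^ 2 / 2)) * volume.real S :=
          le_mul_of_one_le_right (Real.exp_pos _).le hvol
      _ ≤ _ := setIntegral_ge_of_const_le_real hSc.measurableSet hSc.measure_lt_top.ne hbound
          (ContinuousOn.integrableOn_compact hSc (by fun_prop))
  calc _ = Real.exp ((k : ℝ) ^ 4 * β / (4 * n)) *
        Real.exp (-c * (2 * ∑ p, A p ^ 2 + (k : ℝ) ^ 2 / 2)) := by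
        rw [hlhs, ← Real.exp_add]
        congr 1
        rw [hc]
        field_simp
        ring
    _ ≤ _ := by gcongr
end

section
/- Fix an integer k ≥ 3 and let f : [1/k, 1] → ℝ be defined by f(r) = h(x_r) + (k−1)·h(y_r) for h(x) = −x·log x, where x_r = (1 + √((k−1)(kr−1)))/k and y_r = (1 − x_r)/(k−1). Then for every c ≤ (k−1)·log(k−1), every 0 ≤ s ≤ k−1 and every 0 ≤ t ≤ 1 − s/(k−1), one has c·s/(k−1)² ≤ (1−t)·( f(1/k) − f(1/k + s/(k(1−t))) ) (with both sides interpreted as 0 when t = 1, which forces s = 0). -/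
open Set

/-- `x_r = (1 + √((k-1)(kr-1)))/k`. -/
noncomputable def xR (k : ℕ) (r : ℝ) : ℝ :=
  (1 + Real.sqrt (((k : ℝ) - 1) * ((k : ℝ) * r - 1))) / (k : ℝ)

/-- `y_r = (1 - x_r)/(k-1)`. -/
noncomputable def yR (k : ℕ) (r : ℝ) : ℝ := (1 - xR k r) / ((k : ℝ) - 1)

/-- `f(r) = h(x_r) + (k-1) h(y_r)` for `h(x) = -x log x`. -/
noncomputable def fEnt (k : ℕ) (r : ℝ) : ℝ :=
  (fun x : ℝ => -x * Real.log x) (xR k r) +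
    ((k : ℝ) - 1) * (fun x : ℝ => -x * Real.log x) (yR k r)

theorem mul_log_sub_log_le_mul_log_sub_log {v w : ℝ} (hv : 0 ≤ v) (hvw : v ≤ w) (hw : w < 1) :
    w * (Real.log (1 + v) - Real.log (1 - v)) ≤ v * (Real.log (1 + w) - Real.log (1 - w)) := by
  have sv := (Real.hasSum_log_sub_log_of_abs_lt_one
    (x := v) (abs_lt.2 ⟨by linarith, by linarith⟩)).mul_left w
  have sw := (Real.hasSum_log_sub_log_of_abs_lt_one
    (x := w) (abs_lt.2 ⟨by linarith, by linarith⟩)).mul_left v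
  refine hasSum_le (fun j => ?_) sv sw
  have hpow : v ^ (2 * j) ≤ w ^ (2 * j) := pow_le_pow_left₀ hv hvw _
  have hcoef : 0 ≤ w * v * (2 * (1 / (2 * (j : ℝ) + 1))) :=
    mul_nonneg (mul_nonneg (hv.trans hvw) hv) (by positivity)
  calc w * (2 * (1 / (2 * (j : ℝ) + 1)) * v ^ (2 * j + 1))
      = w * v * (2 * (1 / (2 * (j : ℝ) + 1))) * v ^ (2 * j) := by ring
    _ ≤ w * v * (2 * (1 / (2 * (j : ℝ) + 1))) * w ^ (2 * j) :=
        mul_le_mul_of_nonneg_left hpow hcoef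
    _ = v * (2 * (1 / (2 * (j : ℝ) + 1)) * w ^ (2 * j + 1)) := by ring

/-- The negative of the binary entropy of `((1 + v) / 2, (1 - v) / 2)`, up to affine
normalisation. -/
noncomputable def symmNegEntropy (v : ℝ) : ℝ :=
  (1 + v) * Real.log (1 + v) + (1 - v) * Real.log (1 - v)

theorem symmNegEntropy_neg (v : ℝ) : symmNegEntropy (-v) = symmNegEntropy v := by
  simp only [symmNegEntropy, sub_neg_eq_add, ← sub_eq_add_neg]
  ring

theorem continuous_symmNegEntropy : Continuous symmNegEntropy :=
  (Real.continuous_mul_log.comp (continuous_const.add continuous_id)).add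
    (Real.continuous_mul_log.comp (continuous_const.sub continuous_id))

theorem hasDerivAt_symmNegEntropy {v : ℝ} (h₁ : -1 < v) (h₂ : v < 1) :
    HasDerivAt symmNegEntropy (Real.log (1 + v) - Real.log (1 - v)) v := by
  have d₁ := (Real.hasDerivAt_mul_log (x := 1 + v) (by linarith)).comp v
    ((hasDerivAt_id v).const_add 1)
  have d₂ := (Real.hasDerivAt_mul_log (x := 1 - v) (by linarith)).comp v
    ((hasDerivAt_id v).const_sub 1)
  refine (d₁.add d₂).congr_deriv ?_
  ring

/-- `symmNegEntropy` is a convex function of `v ^ 2`, so it lies above its tangent line in `v ^ 2`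
at `w ^ 2`. -/
theorem symmNegEntropy_tangent_le {v w : ℝ} (hw₀ : 0 < w) (hw₁ : w < 1) (hv : |v| ≤ 1) :
    symmNegEntropy w + (Real.log (1 + w) - Real.log (1 - w)) / (2 * w) * (v ^ 2 - w ^ 2) ≤
      symmNegEntropy v := by
  wlog hv₀ : 0 ≤ v generalizing v
  · have := this (v := -v) (by rwa [abs_neg]) (by linarith)
    rwa [symmNegEntropy_neg, neg_sq] at this
  have hv₁ : v ≤ 1 := (le_abs_self v).trans hv
  set m := (Real.log (1 + w) - Real.log (1 - w)) / (2 * w) with hm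
  have hmw : Real.log (1 + w) - Real.log (1 - w) = 2 * m * w := by
    rw [hm]; field_simp
  let D : ℝ → ℝ := fun z => symmNegEntropy z - m * z ^ 2
  have hcont : Continuous D :=
    continuous_symmNegEntropy.sub (continuous_const.mul (continuous_pow 2))
  have hderiv {z : ℝ} (h₁ : -1 < z) (h₂ : z < 1) :
      HasDerivAt D (Real.log (1 + z) - Real.log (1 - z) - 2 * m * z) z := by
    refine ((hasDerivAt_symmNegEntropy h₁ h₂).sub ((hasDerivAt_pow 2 z).const_mul m)).congr_deriv ?_
    push_cast
    ring
  have hmin : D w ≤ D v := by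
    rcases le_total v w with hvw | hwv
    · have hanti : AntitoneOn D (Icc 0 w) := by
        refine antitoneOn_of_deriv_nonpos (convex_Icc 0 w) hcont.continuousOn ?_ ?_ <;>
          rw [interior_Icc] <;> rintro z ⟨hz₀, hz₁⟩
        · exact (hderiv (by linarith) (by linarith)).differentiableAt.differentiableWithinAt
        · rw [(hderiv (by linarith) (by linarith)).deriv]
          have := mul_log_sub_log_le_mul_log_sub_log hz₀.le hz₁.le hw₁
          rw [hmw] at this
          refine sub_nonpos.2 (le_of_mul_le_mul_left ?_ hw₀)
          linarith
      exact hanti ⟨hv₀, hvw⟩ ⟨hw₀.le, le_rfl⟩ hvw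
    · have hmono : MonotoneOn D (Icc w 1) := by
        refine monotoneOn_of_deriv_nonneg (convex_Icc w 1) hcont.continuousOn ?_ ?_ <;>
          rw [interior_Icc] <;> rintro z ⟨hz₀, hz₁⟩
        · exact (hderiv (by linarith) (by linarith)).differentiableAt.differentiableWithinAt
        · rw [(hderiv (by linarith) (by linarith)).deriv]
          have := mul_log_sub_log_le_mul_log_sub_log hw₀.le hz₀.le hz₁
          rw [hmw] at this
          refine sub_nonneg.2 (le_of_mul_le_mul_left ?_ hw₀)
          linarith
      exact hmono ⟨le_rfl, hw₁.le⟩ ⟨hwv, hv₁⟩ hwv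
  simp only [D] at hmin
  linarith

theorem mul_log_div {a b : ℝ} (hb : b ≠ 0) :
    a * Real.log (a / b) = a * Real.log a - a * Real.log b := by
  rcases eq_or_ne a 0 with rfl | ha
  · simp
  · rw [Real.log_div ha hb]; ring

theorem fEnt_one_div {k : ℕ} (hk : 2 ≤ k) : fEnt k (1 / (k : ℝ)) = Real.log k := by
  have hk' : (2 : ℝ) ≤ k := by exact_mod_cast hk
  have hk₀ : (k : ℝ) ≠ 0 := by positivity
  have hk₁ : (k : ℝ) - 1 ≠ 0 := by linarith
  have hx : xR k (1 / (k : ℝ)) = 1 / k := by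
    simp [xR, mul_inv_cancel₀ hk₀]
  have hy : yR k (1 / (k : ℝ)) = 1 / k := by
    rw [yR, hx]; field_simp
  rw [fEnt, hx, hy, one_div]
  simp only [Real.log_inv]
  field_simp
  ring

theorem fEnt_eq_symmNegEntropy {k : ℕ} (hk : 2 ≤ k) {r v : ℝ} (hx : xR k r = (1 + v) / 2) :
    fEnt k r = Real.log 2 + (1 - v) / 2 * Real.log ((k : ℝ) - 1) - symmNegEntropy v / 2 := by
  have hk' : (2 : ℝ) ≤ k := by exact_mod_cast hk
  have hk₁ : (k : ℝ) - 1 ≠ 0 := by linarith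
  have hy : yR k r = (1 - v) / (2 * ((k : ℝ) - 1)) := by
    rw [yR, hx]; field_simp; ring
  have e₁ := mul_log_div (a := 1 + v) (b := 2) two_ne_zero
  have e₂ := mul_log_div (a := 1 - v) (b := 2 * ((k : ℝ) - 1)) (mul_ne_zero two_ne_zero hk₁)
  rw [Real.log_mul two_ne_zero hk₁] at e₂
  have e₃ : ((k : ℝ) - 1) * (-((1 - v) / (2 * ((k : ℝ) - 1)))
      * Real.log ((1 - v) / (2 * ((k : ℝ) - 1))))
      = -((1 - v) * Real.log ((1 - v) / (2 * ((k : ℝ) - 1)))) / 2 := by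
    field_simp
  simp only [fEnt, hx, hy, symmNegEntropy]
  rw [e₃, e₂]
  linarith

theorem symmNegEntropy_sub_one_div_add_one {n : ℝ} (hn : 0 < n) :
    symmNegEntropy ((n - 1) / (n + 1)) =
      2 * Real.log 2 - 2 * Real.log (n + 1) + 2 * n / (n + 1) * Real.log n := by
  have hn₁ : n + 1 ≠ 0 := by positivity
  have e₁ : 1 + (n - 1) / (n + 1) = 2 * n / (n + 1) := by field_simp; ring
  have e₂ : 1 - (n - 1) / (n + 1) = 2 / (n + 1) := by field_simp; ring
  rw [symmNegEntropy, e₁, e₂, Real.log_div (by positivity) hn₁, Real.log_div two_ne_zero hn₁,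
    Real.log_mul two_ne_zero hn.ne']
  field_simp
  ring

theorem log_mul_div_le_fEnt_sub_fEnt {k : ℕ} (hk : 3 ≤ k) {u : ℝ} (hu₀ : 0 ≤ u)
    (hu : u ≤ (k : ℝ) - 1) :
    Real.log ((k : ℝ) - 1) * u / ((k : ℝ) - 1) ≤
      fEnt k (1 / (k : ℝ)) - fEnt k (1 / (k : ℝ) + u / k) := by
  have hk' : (3 : ℝ) ≤ k := by exact_mod_cast hk
  obtain ⟨n, hn⟩ : ∃ n : ℝ, n = (k : ℝ) - 1 := ⟨_, rfl⟩
  have hkn : (k : ℝ) = n + 1 := by linarith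
  have hn₂ : 2 ≤ n := by linarith
  have hn₁ : 0 < n - 1 := by linarith
  have hn₀ : 0 < n := by linarith
  rw [← hn] at hu
  have hL : 0 ≤ Real.log n := Real.log_nonneg (by linarith)
  obtain ⟨w, hw⟩ : ∃ w : ℝ, w = √(n * u) := ⟨_, rfl⟩
  have hw₀ : 0 ≤ w := hw ▸ Real.sqrt_nonneg _
  have hw_sq : w ^ 2 = n * u := by rw [hw, Real.sq_sqrt (by positivity)]
  have hwn : w ≤ n := by
    rw [hw]
    exact Real.sqrt_le_iff.2 ⟨hn₀.le, by nlinarith⟩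
  obtain ⟨v, hv⟩ : ∃ v : ℝ, v = (2 * w + 1 - n) / (n + 1) := ⟨_, rfl⟩
  have hx : xR k (1 / (k : ℝ) + u / k) = (1 + v) / 2 := by
    have : (k : ℝ) * (1 / (k : ℝ) + u / k) - 1 = u := by
      have : (k : ℝ) ≠ 0 := by positivity
      field_simp
      ring
    rw [xR, this, ← hn, ← hw, hkn, hv]
    field_simp
    ring
  have hv_abs : |v| ≤ 1 := by
    rw [hv, abs_le, le_div_iff₀ (by positivity), div_le_iff₀ (by positivity)]
    constructor <;> linarith
  have htan := symmNegEntropy_tangent_le (v := v) (w := (n - 1) / (n + 1)) (by positivity)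
    ((div_lt_one (by positivity)).2 (by linarith)) hv_abs
  have hlog : Real.log (1 + (n - 1) / (n + 1)) - Real.log (1 - (n - 1) / (n + 1))
      = Real.log n := by
    have e₁ : 1 + (n - 1) / (n + 1) = 2 / (n + 1) * n := by field_simp; ring
    have e₂ : 1 - (n - 1) / (n + 1) = 2 / (n + 1) := by field_simp; ring
    rw [e₁, e₂, Real.log_mul (by positivity) hn₀.ne']
    ring
  rw [hlog, symmNegEntropy_sub_one_div_add_one hn₀] at htan
  rw [fEnt_one_div (by omega), fEnt_eq_symmNegEntropy (by omega) hx, ← hn, hkn]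
  have hquad : 2 * n / (n + 1) * Real.log n
      + Real.log n / (2 * ((n - 1) / (n + 1))) * (v ^ 2 - ((n - 1) / (n + 1)) ^ 2)
      - (1 - v) * Real.log n = 2 * (Real.log n * w ^ 2 / ((n - 1) * (n + 1))) := by
    rw [hv]
    field_simp
    ring
  have hcmp : Real.log n * u / n ≤ Real.log n * w ^ 2 / ((n - 1) * (n + 1)) := by
    rw [hw_sq, div_le_div_iff₀ hn₀ (by positivity)]
    nlinarith [mul_nonneg hL hu₀]
  linarith

/-- The key inequality in the proof of Theorem 7: for `k ≥ 3`, `c ≤ (k-1) log (k-1)`,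
`0 ≤ s ≤ k-1` and `0 ≤ t ≤ 1 - s/(k-1)`,
`cs/(k-1)² ≤ (1-t) (f(1/k) - f(1/k + s/(k(1-t))))`. -/
theorem key_inequality (k : ℕ) (hk : 3 ≤ k) (c : ℝ)
    (hc : c ≤ ((k : ℝ) - 1) * Real.log ((k : ℝ) - 1))
    (s t : ℝ) (hs₀ : 0 ≤ s) (hs : s ≤ (k : ℝ) - 1)
    (ht₀ : 0 ≤ t) (ht : t ≤ 1 - s / ((k : ℝ) - 1)) :
    c * s / ((k : ℝ) - 1) ^ 2 ≤
      (1 - t) * (fEnt k (1 / (k : ℝ)) - fEnt k (1 / (k : ℝ) + s / ((k : ℝ) * (1 - t)))) := by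
  have hk' : (3 : ℝ) ≤ k := by exact_mod_cast hk
  have hn₀ : 0 < (k : ℝ) - 1 := by linarith
  have hst : s ≤ (1 - t) * ((k : ℝ) - 1) := (div_le_iff₀ hn₀).1 (by linarith)
  have ht₁ : 0 ≤ 1 - t := (div_nonneg hs₀ hn₀.le).trans (by linarith)
  rcases ht₁.eq_or_lt with h | h
  · have : s = 0 := le_antisymm (by simpa [← h] using hst) hs₀
    simp [← h, this]
  have hmain := log_mul_div_le_fEnt_sub_fEnt hk (div_nonneg hs₀ h.le)
    ((div_le_iff₀' h).2 hst)
  rw [div_div, mul_comm (1 - t) (k : ℝ)] at hmain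
  calc c * s / ((k : ℝ) - 1) ^ 2
      ≤ ((k : ℝ) - 1) * Real.log ((k : ℝ) - 1) * s / ((k : ℝ) - 1) ^ 2 := by gcongr
    _ = (1 - t) * (Real.log ((k : ℝ) - 1) * (s / (1 - t)) / ((k : ℝ) - 1)) := by
        field_simp
    _ ≤ _ := mul_le_mul_of_nonneg_left hmain h.le
end
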